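/- arXiv:2404.06200 — 2 statements merged into one kernel-verified Lean document; each statement's English description precedes it below -/
import Mathlib

section
/- Let K be a real symmetric n×n matrix of the form K = σ_ξ²I + C, where σ_ξ² > 0 and C is symmetric positive semidefinite with diagonal entries C_ii = σ_f² and off-diagonal entries C_ij = σ_f² − ε_ij, where 0 ≤ ε_ij ≤ σ_f² and ε_ij = ε_ji. Let ε_min = min_{i≠j} ε_ij and let 𝟙 be the all-ones vector in ℝⁿ. Then (σ_f² + σ_ξ² + (n−1)(σ_f² − ε_min))⁻¹ ≤ n⁻¹·𝟙ᵀK⁻¹𝟙 ≤ 1/σ_ξ². -/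
open Matrix

namespace Matrix

variable {ι : Type*} [Fintype ι]

/-- Variational lower bound for `bᵀ K⁻¹ b`, where `x` solves `K x = b`. -/
lemma PosSemidef.two_mul_dotProduct_sub_le {K : Matrix ι ι ℝ} (hK : K.PosSemidef)
    {x b : ι → ℝ} (hx : K *ᵥ x = b) (v : ι → ℝ) :
    2 * (v ⬝ᵥ b) - v ⬝ᵥ (K *ᵥ v) ≤ b ⬝ᵥ x := by
  have hsymm : x ⬝ᵥ (K *ᵥ v) = v ⬝ᵥ b := by
    have hT : Kᵀ = K := by simpa using hK.isHermitian.eq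
    rw [dotProduct_mulVec, ← mulVec_transpose, hT, hx, dotProduct_comm]
  have hnonneg := hK.dotProduct_mulVec_nonneg (x - v)
  simp only [star_trivial, mulVec_sub, sub_dotProduct, dotProduct_sub, hx, hsymm] at hnonneg
  rw [dotProduct_comm b x]
  linarith

/-- If `K ≥ a I` with `a ≥ 0` in the Loewner order and `K x = b`, then `a xᵀb ≤ bᵀb`. -/
lemma PosSemidef.mul_dotProduct_le_of_smul_one_add [DecidableEq ι] {C : Matrix ι ι ℝ}
    (hC : C.PosSemidef) {a : ℝ} (ha : 0 ≤ a) {x b : ι → ℝ} (hx : (a • 1 + C) *ᵥ x = b) :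
    a * (b ⬝ᵥ x) ≤ b ⬝ᵥ b := by
  have hquad : a * (x ⬝ᵥ x) ≤ b ⬝ᵥ x := by
    have hnonneg := hC.dotProduct_mulVec_nonneg x
    rw [dotProduct_comm b x, ← hx]
    simpa [add_mulVec, smul_mulVec] using hnonneg
  have hsq : 0 ≤ (b - a • x) ⬝ᵥ (b - a • x) :=
    Finset.sum_nonneg fun i _ => mul_self_nonneg _
  simp only [sub_dotProduct, dotProduct_sub, smul_dotProduct, dotProduct_smul, smul_eq_mul,
    dotProduct_comm x b] at hsq
  nlinarith [mul_le_mul_of_nonneg_left hquad ha]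

end Matrix

/-- bounds on `n⁻¹ 𝟙ᵀ K⁻¹ 𝟙` for a kernel Gram matrix
`K = σ_ξ² I + C` with `C` PSD, diagonal `σ_f²` and off-diagonal `σ_f² - ε i j`,
where `ε_min` is the minimum off-diagonal `ε` value. -/
theorem stmt1 {n : ℕ} (hn : 0 < n) (σξ2 σf2 : ℝ) (hσξ : 0 < σξ2)
    (C : Matrix (Fin n) (Fin n) ℝ) (hC : C.PosSemidef)
    (ε : Fin n → Fin n → ℝ)
    (hdiag : ∀ i, C i i = σf2)
    (hoff : ∀ i j, i ≠ j → C i j = σf2 - ε i j)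
    (hε0 : ∀ i j, i ≠ j → 0 ≤ ε i j) (hε1 : ∀ i j, i ≠ j → ε i j ≤ σf2)
    (hεsym : ∀ i j, ε i j = ε j i)
    (εmin : ℝ) (hεmin : IsLeast {x : ℝ | ∃ i j, i ≠ j ∧ x = ε i j} εmin)
    (K : Matrix (Fin n) (Fin n) ℝ) (hK : K = σξ2 • 1 + C) :
    (σf2 + σξ2 + ((n : ℝ) - 1) * (σf2 - εmin))⁻¹
        ≤ (n : ℝ)⁻¹ * ((fun _ => (1 : ℝ)) ⬝ᵥ (K⁻¹ *ᵥ fun _ => (1 : ℝ))) ∧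
    (n : ℝ)⁻¹ * ((fun _ => (1 : ℝ)) ⬝ᵥ (K⁻¹ *ᵥ fun _ => (1 : ℝ))) ≤ 1 / σξ2 := by
  have hPD : K.PosDef := by
    rw [hK]
    exact (PosDef.one.smul hσξ).add_posSemidef hC
  have hsolve : K *ᵥ (K⁻¹ *ᵥ fun _ => (1 : ℝ)) = fun _ => 1 := by
    rw [mulVec_mulVec, mul_nonsing_inv _ ((isUnit_iff_isUnit_det K).1 hPD.isUnit), one_mulVec]
  have hnpos : (0 : ℝ) < n := Nat.cast_pos.2 hn
  have hone : (fun _ : Fin n => (1 : ℝ)) ⬝ᵥ (fun _ => 1) = n := by simp [dotProduct]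
  constructor
  · set D := σf2 + σξ2 + ((n : ℝ) - 1) * (σf2 - εmin) with hD
    have hDpos : 0 < D := by
      obtain ⟨i, j, hij, rfl⟩ := hεmin.1
      have hn1 : (1 : ℝ) ≤ n := Nat.one_le_cast.2 hn
      have hprod := mul_nonneg (sub_nonneg.2 hn1) (sub_nonneg.2 (hε1 i j hij))
      linarith [hε0 i j hij, hε1 i j hij]
    have hentry (i j : Fin n) :
        K i j ≤ (σf2 - εmin) + if i = j then σξ2 + εmin else 0 := by
      by_cases hij : i = j
      · subst hij
        simp only [hK, Matrix.add_apply, Matrix.smul_apply, one_apply_eq, hdiag, smul_eq_mul, if_true]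
        linarith
      · simp only [hK, Matrix.add_apply, Matrix.smul_apply, one_apply_ne hij, hoff i j hij, smul_eq_mul,
          if_neg hij]
        linarith [hεmin.2 ⟨i, j, hij, rfl⟩]
    have hrow (i : Fin n) : ∑ j, K i j ≤ D := by
      refine (Finset.sum_le_sum fun j _ => hentry i j).trans (le_of_eq ?_)
      simp only [Finset.sum_add_distrib, Finset.sum_const, Finset.card_univ, Fintype.card_fin,
        nsmul_eq_mul, Finset.sum_ite_eq, Finset.mem_univ, if_true, hD]
      ring
    have hsum : (fun _ => (1 : ℝ)) ⬝ᵥ (K *ᵥ fun _ => 1) ≤ n * D := by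
      simpa [dotProduct, mulVec] using Finset.sum_le_sum fun i (_ : i ∈ Finset.univ) => hrow i
    have hvar := hPD.posSemidef.two_mul_dotProduct_sub_le hsolve (D⁻¹ • fun _ => (1 : ℝ))
    simp only [mulVec_smul, smul_dotProduct, dotProduct_smul, smul_eq_mul, hone] at hvar
    have hscaled : D⁻¹ * (D⁻¹ * ((fun _ => (1 : ℝ)) ⬝ᵥ (K *ᵥ fun _ => 1))) ≤ D⁻¹ * n := by
      calc _ ≤ D⁻¹ * (D⁻¹ * (n * D)) := by gcongr
        _ = D⁻¹ * n := by field_simp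
    rw [le_inv_mul_iff₀ hnpos]
    linarith
  · have hupper := hC.mul_dotProduct_le_of_smul_one_add hσξ.le (hK ▸ hsolve)
    rw [hone, ← hK] at hupper
    rw [inv_mul_le_iff₀ hnpos, mul_one_div, le_div_iff₀ hσξ, mul_comm]
    exact hupper
end

section
/- Let A and E be real m×m matrices with A invertible, set Q = A⁻¹ and K = A + E, and let ‖·‖ be the operator norm on matrices induced by the supremum norm on ℝᵐ (the maximum absolute row sum norm), which is submultiplicative. Assume ‖QE‖ < 1. Then K is invertible, K⁻¹ = Σ_{k=0}^∞ (−1)^k (QE)^k Q (the Neumann series converging in norm), and the second-order truncation satisfies the exact identity and error bound ‖K⁻¹ − (3Q − 3QKQ + QKQKQ)‖ ≤ ‖Q‖·‖QE‖³/(1 − ‖QE‖). -/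
open Matrix

attribute [local instance] Matrix.linftyOpNormedAddCommGroup Matrix.linftyOpNormedRing

theorem norm_pow_mul_le_pow_mul {R : Type*} [SeminormedRing R] (x q : R) (k : ℕ) :
    ‖x ^ k * q‖ ≤ ‖q‖ * ‖x‖ ^ k := by
  induction k with
  | zero => simp
  | succ k ih =>
    calc ‖x ^ (k + 1) * q‖ = ‖x * (x ^ k * q)‖ := by rw [pow_succ', mul_assoc]
      _ ≤ ‖x‖ * (‖q‖ * ‖x‖ ^ k) := (norm_mul_le _ _).trans (by gcongr)
      _ = ‖q‖ * ‖x‖ ^ (k + 1) := by ring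

/-- The error of a truncated Neumann series, without assuming `‖1‖ = 1`. -/
theorem norm_tsum_pow_mul_sub_sum_le {R : Type*} [NormedRing R] [HasSummableGeomSeries R]
    (x q : R) (hx : ‖x‖ < 1) (n : ℕ) :
    ‖(∑' k : ℕ, x ^ k) * q - ∑ k ∈ Finset.range n, x ^ k * q‖
      ≤ ‖q‖ * ‖x‖ ^ n / (1 - ‖x‖) := by
  rw [norm_sub_rev]
  exact norm_sub_le_of_geometric_bound_of_hasSum hx (norm_pow_mul_le_pow_mul x q)
    ((summable_geometric_of_norm_lt_one hx).hasSum.mul_right q) n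

/-- Neumann-series inverse and second-order truncation error bound.
With `Q = A⁻¹`, `K = A + E` and `‖QE‖ < 1` in the maximum-absolute-row-sum operator
norm, `K` is invertible, `K⁻¹ = ∑ₖ (-1)ᵏ (QE)ᵏ Q`, and
`‖K⁻¹ - (3Q - 3QKQ + QKQKQ)‖ ≤ ‖Q‖‖QE‖³/(1 - ‖QE‖)`. -/
theorem stmt11 {m : ℕ} (A E : Matrix (Fin m) (Fin m) ℝ) (hA : IsUnit A.det)
    (Q K : Matrix (Fin m) (Fin m) ℝ) (hQ : Q = A⁻¹) (hK : K = A + E)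
    (hQE : ‖Q * E‖ < 1) :
    IsUnit K.det ∧
    K⁻¹ = ∑' k : ℕ, (-1 : ℝ) ^ k • ((Q * E) ^ k * Q) ∧
    ‖K⁻¹ - (3 • Q - 3 • (Q * K * Q) + Q * K * Q * K * Q)‖
      ≤ ‖Q‖ * ‖Q * E‖ ^ 3 / (1 - ‖Q * E‖) := by
  have hQA : Q * A = 1 := hQ ▸ nonsing_inv_mul A hA
  let _ : NormedSpace ℝ (Matrix (Fin m) (Fin m) ℝ) := Matrix.linftyOpNormedSpace
  have : CompleteSpace (Matrix (Fin m) (Fin m) ℝ) := FiniteDimensional.complete ℝ _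
  have hx : ‖-(Q * E)‖ < 1 := by rwa [norm_neg]
  have hQK : Q * K = 1 - -(Q * E) := by rw [hK, mul_add, hQA, sub_neg_eq_add]
  have hinv : ((∑' k : ℕ, (-(Q * E)) ^ k) * Q) * K = 1 := by
    rw [mul_assoc, hQK]
    exact geom_series_mul_neg _ hx
  have hKinv : K⁻¹ = (∑' k : ℕ, (-(Q * E)) ^ k) * Q := inv_eq_left_inv hinv
  refine ⟨isUnit_det_of_left_inverse hinv, ?_, ?_⟩
  · have hterm (k : ℕ) : (-1 : ℝ) ^ k • ((Q * E) ^ k * Q) = (-(Q * E)) ^ k * Q := by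
      rw [← smul_mul_assoc, ← smul_pow, neg_one_smul]
    simp_rw [hterm]
    rw [hKinv]
    exact ((summable_geometric_of_norm_lt_one hx).hasSum.mul_right Q).tsum_eq.symm
  · have htrunc : 3 • Q - 3 • (Q * K * Q) + Q * K * Q * K * Q
        = ∑ k ∈ Finset.range 3, (-(Q * E)) ^ k * Q := by
      rw [mul_assoc (Q * K) Q K, hQK]
      simp only [Finset.sum_range_succ, Finset.sum_range_zero]
      noncomm_ring
    rw [htrunc, hKinv, ← norm_neg (Q * E)]
    exact norm_tsum_pow_mul_sub_sum_le _ Q hx 3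
end
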